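/- arXiv:1103.1857 — 4 statements merged into one kernel-verified Lean document; each statement's English description precedes it below -/
import Mathlib

section
/- For fixed nonzero n ∈ (ℤ/2ℤ)^{2g}, the number of odd m ∈ (ℤ/2ℤ)^{2g} with σ(m + n) = 0 equals 2^{2g−2}. -/
/-- The parity `σ(m) = ε·δ` of a characteristic `m = (ε, δ) ∈ (ℤ/2ℤ)^{2g}`. -/
def parity {g : ℕ} (m : (Fin g → ZMod 2) × (Fin g → ZMod 2)) : ZMod 2 :=
  ∑ i, m.1 i * m.2 i

theorem parity_add_aux {g : ℕ} (m n : (Fin g → ZMod 2) × (Fin g → ZMod 2)) :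
    parity (m + n) = parity m + parity n + ∑ i, (m.1 i * n.2 i + m.2 i * n.1 i) := by
  simp only [parity, ← Finset.sum_add_distrib]
  refine Finset.sum_congr rfl fun i _ => ?_
  simp only [Prod.fst_add, Prod.snd_add, Pi.add_apply]
  ring

theorem exists_shift_aux {g : ℕ} (n : (Fin g → ZMod 2) × (Fin g → ZMod 2)) (hn : n ≠ 0) :
    ∃ e : (Fin g → ZMod 2) × (Fin g → ZMod 2),
      ∑ i, (e.1 i * n.2 i + e.2 i * n.1 i) = 1 := by
  have h2 : ∀ x : ZMod 2, x ≠ 0 → x = 1 := by decide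
  by_cases h : n.1 = 0
  · have h' : n.2 ≠ 0 := fun h' => hn (Prod.ext h h')
    obtain ⟨i, hi⟩ := Function.ne_iff.mp h'
    refine ⟨(Pi.single i 1, 0), ?_⟩
    simpa [Pi.single_apply] using h2 _ hi
  · obtain ⟨i, hi⟩ := Function.ne_iff.mp h
    refine ⟨(0, Pi.single i 1), ?_⟩
    simpa [Pi.single_apply] using h2 _ hi

theorem card_shift_aux {V : Type*} [AddCommGroup V] [Fintype V] (p q : V → Prop)
    [DecidablePred p] [DecidablePred q] (e : V) (h : ∀ m, p m ↔ q (m + e)) :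
    (Finset.univ.filter p).card = (Finset.univ.filter q).card := by
  refine Finset.card_bij' (fun m _ => m + e) (fun m _ => m - e) ?_ ?_ ?_ ?_ <;> simp [h]

theorem card_odd_m_single (g : ℕ) (hg : 1 ≤ g)
    (n : (Fin g → ZMod 2) × (Fin g → ZMod 2)) (hn : n ≠ 0) :
    Nat.card {m : (Fin g → ZMod 2) × (Fin g → ZMod 2) //
        parity m = 1 ∧ parity (m + n) = 0} = 2 ^ (2 * g - 2) := by
  classical
  obtain ⟨e, he⟩ := exists_shift_aux n hn
  have hnn : ∀ m : (Fin g → ZMod 2) × (Fin g → ZMod 2), m + n + n = m := by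
    intro m
    have : n + n = 0 := by ext i <;> exact CharTwo.add_self_eq_zero _
    rw [add_assoc, this, add_zero]
  have key : ∀ m, parity (m + e) + parity (m + e + n) = parity m + parity (m + n) + 1 := by
    intro m
    have h1 := parity_add_aux (m + e) n
    have h2 := parity_add_aux m n
    have h3 : ∑ i, ((m + e).1 i * n.2 i + (m + e).2 i * n.1 i)
        = ∑ i, (m.1 i * n.2 i + m.2 i * n.1 i) + 1 := by
      rw [← he, ← Finset.sum_add_distrib]
      refine Finset.sum_congr rfl fun i _ => ?_
      simp only [Prod.fst_add, Prod.snd_add, Pi.add_apply]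
      ring
    rw [h1, h2, h3]
    generalize parity (m + e) = a
    generalize parity m = b
    generalize parity n = c
    generalize ∑ i, (m.1 i * n.2 i + m.2 i * n.1 i) = d
    revert a b c d
    decide
  rw [Nat.card_eq_fintype_card, Fintype.card_subtype]
  have hAB := card_shift_aux (fun m => parity m = 1 ∧ parity (m + n) = 0)
    (fun m => parity m = 0 ∧ parity (m + n) = 1) n (by intro m; rw [hnn]; tauto)
  have hz : ∀ a : ZMod 2, a = 0 ∨ a = 1 := by decide
  have hCD := card_shift_aux (fun m => parity m + parity (m + n) = 1)
    (fun m => ¬ (parity m + parity (m + n) = 1)) e (by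
      intro m
      rw [key]
      generalize parity m + parity (m + n) = a
      revert a
      decide)
  have hU := Finset.card_filter_add_card_filter_not
    (s := (Finset.univ : Finset ((Fin g → ZMod 2) × (Fin g → ZMod 2))))
    (fun m => parity m + parity (m + n) = 1)
  have hC : (Finset.univ.filter (fun m => parity m + parity (m + n) = 1)).card =
      (Finset.univ.filter (fun m => parity m = 1 ∧ parity (m + n) = 0)).card +
      (Finset.univ.filter (fun m => parity m = 0 ∧ parity (m + n) = 1)).card := by
    rw [← Finset.card_union_of_disjoint, ← Finset.filter_or]
    · congr 1
      refine Finset.filter_congr fun m _ => ?_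
      generalize parity m = a
      generalize parity (m + n) = b
      revert a b
      decide
    · rw [Finset.disjoint_filter]
      rintro m _ ⟨h, _⟩ ⟨h', _⟩
      rw [h] at h'
      exact one_ne_zero h'
  have hV : (Finset.univ : Finset ((Fin g → ZMod 2) × (Fin g → ZMod 2))).card
      = 4 * 2 ^ (2 * g - 2) := by
    obtain ⟨k, rfl⟩ := Nat.exists_eq_add_of_le hg
    have : 2 * (1 + k) - 2 = 2 * k := by omega
    rw [this]
    simp [ZMod.card]
    ring
  omega
end

section
/- Let R be a commutative ℚ-algebra and λ₁, λ₃, λ₅ ∈ R satisfying λ₃² = λ₁³λ₃ − (1/8)λ₁⁶ − 2λ₁λ₅, λ₁⁵λ₃ = (7/48)λ₁⁸ + (8/3)λ₅(λ₁³ + λ₃), and λ₅² = 0. Then λ₁³λ₃λ₅ = (1/5)λ₁⁶λ₅ − (1/7040)λ₁¹¹. -/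
theorem hodge_relation_l1_l3_l5_a (R : Type*) [CommRing R] [Algebra ℚ R]
    (l1 l3 l5 : R)
    (h1 : l3 ^ 2 = l1 ^ 3 * l3 - (1 / 8 : ℚ) • l1 ^ 6 - 2 * l1 * l5)
    (h2 : l1 ^ 5 * l3 = (7 / 48 : ℚ) • l1 ^ 8 + (8 / 3 : ℚ) • (l5 * (l1 ^ 3 + l3)))
    (h3 : l5 ^ 2 = 0) :
    l1 ^ 3 * l3 * l5 = (1 / 5 : ℚ) • (l1 ^ 6 * l5) - (1 / 7040 : ℚ) • l1 ^ 11 := by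

  have key : l1 ^ 3 * l3 * l5 - ((1 / 5 : ℚ) • (l1 ^ 6 * l5) - (1 / 7040 : ℚ) • l1 ^ 11) =
      (-18 / 55 : ℚ) • (l3 * (l1 ^ 5 * l3 - ((7 / 48 : ℚ) • l1 ^ 8 + (8 / 3 : ℚ) • (l5 * (l1 ^ 3 + l3))))
        - l1 ^ 5 * (l3 ^ 2 - (l1 ^ 3 * l3 - (1 / 8 : ℚ) • l1 ^ 6 - 2 * l1 * l5))
        + (8 / 3 : ℚ) • (l5 * (l3 ^ 2 - (l1 ^ 3 * l3 - (1 / 8 : ℚ) • l1 ^ 6 - 2 * l1 * l5)))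
        - (41 / 48 : ℚ) • (l1 ^ 3 * (l1 ^ 5 * l3 - ((7 / 48 : ℚ) • l1 ^ 8 + (8 / 3 : ℚ) • (l5 * (l1 ^ 3 + l3)))))
        - (16 / 3 : ℚ) • (l1 * l5 ^ 2)) := by
    algebra
  rw [← sub_eq_zero, key, sub_eq_zero.mpr h1, sub_eq_zero.mpr h2, h3]
  simp
end

section
/- Let R be a commutative ℚ-algebra and λ₁, λ₃, λ₅ ∈ R satisfying λ₃² = λ₁³λ₃ − (1/8)λ₁⁶ − 2λ₁λ₅, λ₁⁵λ₃ = (7/48)λ₁⁸ + (8/3)λ₅(λ₁³ + λ₃), and λ₅² = 0. Then λ₁¹²λ₃ = (2/13)λ₁¹⁵. -/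
theorem hodge_relation_l1_l3_l5_c (R : Type*) [CommRing R] [Algebra ℚ R]
    (l1 l3 l5 : R)
    (h1 : l3 ^ 2 = l1 ^ 3 * l3 - (1 / 8 : ℚ) • l1 ^ 6 - 2 * l1 * l5)
    (h2 : l1 ^ 5 * l3 = (7 / 48 : ℚ) • l1 ^ 8 + (8 / 3 : ℚ) • (l5 * (l1 ^ 3 + l3)))
    (h3 : l5 ^ 2 = 0) :
    l1 ^ 12 * l3 = (2 / 13 : ℚ) • l1 ^ 15 := by
  have e (q : ℚ) (x : R) : q • x = algebraMap ℚ R q * x := Algebra.smul_def q x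
  have k1 : 8 * l3 ^ 2 = 8 * l1 ^ 3 * l3 - l1 ^ 6 - 16 * l1 * l5 := by
    have h : (8 : R) * algebraMap ℚ R (1 / 8) = 1 := by
      rw [← map_ofNat (algebraMap ℚ R) 8, ← map_mul]; norm_num
    rw [e] at h1
    linear_combination 8 * h1 - l1 ^ 6 * h
  have k2 : 48 * (l1 ^ 5 * l3) = 7 * l1 ^ 8 + 128 * (l5 * (l1 ^ 3 + l3)) := by
    have h : (48 : R) * algebraMap ℚ R (7 / 48) = 7 := by
      rw [← map_ofNat (algebraMap ℚ R) 48, ← map_mul, ← map_ofNat (algebraMap ℚ R) 7]; norm_num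
    have h' : (48 : R) * algebraMap ℚ R (8 / 3) = 128 := by
      rw [← map_ofNat (algebraMap ℚ R) 48, ← map_mul, ← map_ofNat (algebraMap ℚ R) 128]; norm_num
    rw [e, e] at h2
    linear_combination 48 * h2 + l1 ^ 8 * h + l5 * (l1 ^ 3 + l3) * h'
  have h13 : (13 : R) * algebraMap ℚ R (2 / 13) = 2 := by
    rw [← map_ofNat (algebraMap ℚ R) 13, ← map_mul, ← map_ofNat (algebraMap ℚ R) 2]; norm_num
  have hu : algebraMap ℚ R (1 / 29952) * (29952 : R) = 1 := by
    rw [← map_ofNat (algebraMap ℚ R) 29952, ← map_mul]; norm_num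
  have key : (29952 : R) * (l1 ^ 12 * l3 - algebraMap ℚ R (2 / 13) * l1 ^ 15) = 0 := by
    linear_combination ((-85248) * l1 ^ 9 * l3 ^ 0 * l5 ^ 0 + (110592) * l1 ^ 6 * l3 ^ 1 * l5 ^ 0 + (-110592) * l1 ^ 4 * l3 ^ 0 * l5 ^ 1 + (-294912) * l1 ^ 1 * l3 ^ 1 * l5 ^ 1) * k1
      + ((-11520) * l1 ^ 7 * l3 ^ 0 * l5 ^ 0 + (29952) * l1 ^ 4 * l3 ^ 1 * l5 ^ 0 + (-18432) * l1 ^ 1 * l3 ^ 2 * l5 ^ 0) * k2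
      + ((1769472) * l1 ^ 5 * l3 ^ 0 * l5 ^ 0 + (4718592) * l1 ^ 2 * l3 ^ 1 * l5 ^ 0) * h3
      - 2304 * l1 ^ 15 * h13
  rw [e]
  linear_combination algebraMap ℚ R (1 / 29952) * key
    - (l1 ^ 12 * l3 - algebraMap ℚ R (2 / 13) * l1 ^ 15) * hu
end

section
/- Let R be a commutative ℚ-algebra and λ₁, λ₃, λ₅ ∈ R satisfying λ₃² = λ₁³λ₃ − (1/8)λ₁⁶ − 2λ₁λ₅, λ₁⁵λ₃ = (7/48)λ₁⁸ + (8/3)λ₅(λ₁³ + λ₃), and λ₅² = 0. Then λ₁⁹λ₃² = (27/1144)λ₁¹⁵, i.e. λ₁⁹λ₃² = (2/13 − 3/572 − 1/8)·λ₁¹⁵. -/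
theorem hodge_relation_l1_l3_l5_d (R : Type*) [CommRing R] [Algebra ℚ R]
    (l1 l3 l5 : R)
    (h1 : l3 ^ 2 = l1 ^ 3 * l3 - (1 / 8 : ℚ) • l1 ^ 6 - 2 * l1 * l5)
    (h2 : l1 ^ 5 * l3 = (7 / 48 : ℚ) • l1 ^ 8 + (8 / 3 : ℚ) • (l5 * (l1 ^ 3 + l3)))
    (h3 : l5 ^ 2 = 0) :
    l1 ^ 9 * l3 ^ 2 = (27 / 1144 : ℚ) • l1 ^ 15 ∧
      l1 ^ 9 * l3 ^ 2 = (2 / 13 - 3 / 572 - 1 / 8 : ℚ) • l1 ^ 15 := by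
  have key : ∀ (q : ℚ) (n m : ℤ) (x : R), n * q = m → (n : R) * (q • x) = m * x := by
    intro q n m x h
    have := congrArg (algebraMap ℚ R) h
    simp only [map_mul, map_intCast] at this
    rw [Algebra.smul_def, ← mul_assoc, this]
  have cancel : ∀ (n : ℤ) (x y : R), n ≠ 0 → (n : R) * x = n * y → x = y := by
    intro n x y hn h
    have hq : (n : ℚ) ≠ 0 := by exact_mod_cast hn
    have hu := congrArg (algebraMap ℚ R) (inv_mul_cancel₀ hq)
    simp only [map_mul, map_intCast, map_one] at hu
    calc x = algebraMap ℚ R (n : ℚ)⁻¹ * (n * x) := by rw [← mul_assoc, hu, one_mul]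
      _ = y := by rw [h, ← mul_assoc, hu, one_mul]
  have e1 := key (1 / 8) 8 1 (l1 ^ 6) (by norm_num)
  have e2 := key (7 / 48) 48 7 (l1 ^ 8) (by norm_num)
  have e3 := key (8 / 3) 48 128 (l5 * (l1 ^ 3 + l3)) (by norm_num)
  have e4 := key (27 / 1144) 1144 27 (l1 ^ 15) (by norm_num)
  push_cast at e1 e2 e3 e4
  have H1 : 8 * l3 ^ 2 = 8 * l1 ^ 3 * l3 - l1 ^ 6 - 16 * l1 * l5 := by
    linear_combination 8 * h1 - e1
  have H2 : 48 * (l1 ^ 5 * l3) = 7 * l1 ^ 8 + 128 * (l5 * (l1 ^ 3 + l3)) := by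
    linear_combination 48 * h2 + e2 + e3
  -- multiply `H2` by `l5`
  have H3 : 48 * (l1 ^ 5 * l3 * l5) = 7 * (l1 ^ 8 * l5) := by
    linear_combination l5 * H2 + 128 * (l1 ^ 3 + l3) * h3
  have H4 : 144 * (l1 ^ 12 * l3) = 21 * l1 ^ 15 + 440 * (l1 ^ 10 * l5) := by
    linear_combination 3 * l1 ^ 7 * H2 + 8 * l1 ^ 2 * H3
  -- multiply `H2` by `l3`
  have H5 : 41 * (l1 ^ 8 * l3) = 6 * l1 ^ 11 + 80 * (l1 ^ 6 * l5) + 256 * (l1 ^ 3 * l3 * l5) := by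
    linear_combination l3 * H2 - 6 * l1 ^ 5 * H1 + 16 * l5 * H1 - 256 * l1 * h3
  have H6 : 1144 * (l1 ^ 10 * l5) = 3 * l1 ^ 15 := by
    linear_combination 144 * l1 ^ 4 * H5 - 41 * H4 + 768 * l1 ^ 2 * H3
  have H7 : l1 ^ 9 * l3 ^ 2 = (27 / 1144 : ℚ) • l1 ^ 15 := by
    refine cancel (1144 * 144) _ _ (by norm_num) ?_
    push_cast
    linear_combination 1144 * 18 * l1 ^ 9 * H1 + 1144 * H4 + 152 * H6 - 144 * e4
  refine ⟨H7, ?_⟩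
  rw [H7]
  norm_num
end
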